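/- Let p : [0,1) → ℝ be integrable and n ∈ ℕ, n ≥ 1, with max_{0≤k<2^n} 2^{-n}|S_{2^n}p(k/2^n)| < 1/2. For 0 ≤ k < 2^n set ρ^{(n)}_k = (2^{-n} S_{2^n}p(k/2^n)) / (1 − 2^{-(n+1)} S_{2^n}p(k/2^n)). Then for all integers 0 ≤ a ≤ b ≤ 2^n: Π_{j=a}^{b−1} (1 + |ρ^{(n)}_j|) ≤ e^{2 ∫₀¹ |p(x)| dx}. -/

import Mathlib

open MeasureTheory Matrix

/-- The `k`-th binary digit of `x ∈ [0,1)`, using the expansion terminating in zeros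
for dyadic rationals. -/
noncomputable def binDigit (k : ℕ) (x : ℝ) : ℕ := ⌊x * 2 ^ (k + 1)⌋.toNat % 2

/-- Rademacher functions `r_k(x) = (-1)^{x_k}`. -/
noncomputable def rademacher (k : ℕ) (x : ℝ) : ℝ := (-1 : ℝ) ^ binDigit k x

/-- Walsh–Paley functions `ω_n(x) = ∏_k r_k(x)^{n_k}`. -/
noncomputable def walsh (n : ℕ) (x : ℝ) : ℝ :=
  ∏ k ∈ Finset.range n, if n.testBit k then rademacher k x else 1

/-- Walsh–Fourier coefficient `f̂_k = ∫₀¹ f ω_k`. -/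
noncomputable def fcoef (f : ℝ → ℝ) (k : ℕ) : ℝ := ∫ x in (0:ℝ)..1, f x * walsh k x

/-- The `2^n`-th partial sum of the Walsh–Fourier series:
`S_{2^n} f (x) = ∑_{k<2^n} f̂_k ω_k(x)`. -/
noncomputable def S2 (n : ℕ) (f : ℝ → ℝ) (x : ℝ) : ℝ :=
  ∑ k ∈ Finset.range (2 ^ n), fcoef f k * walsh k x

/-- Distributing a product over binary digits. -/
theorem sum_range_two_pow_prod_testBit (n : ℕ) (f : ℕ → Bool → ℝ) :
    ∑ k ∈ Finset.range (2 ^ n), ∏ i ∈ Finset.range n, f i (k.testBit i) =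
      ∏ i ∈ Finset.range n, (f i false + f i true) := by
  induction n with
  | zero => simp
  | succ n ih =>
    rw [pow_succ, mul_two, Finset.sum_range_add, Finset.prod_range_succ, ← ih, mul_add,
      Finset.sum_mul, Finset.sum_mul]
    congr 1 <;> refine Finset.sum_congr rfl fun k hk => ?_
    · rw [Finset.prod_range_succ, Nat.testBit_lt_two_pow (Finset.mem_range.mp hk)]
    · rw [Finset.prod_range_succ, Nat.testBit_two_pow_add_eq,
        Nat.testBit_lt_two_pow (Finset.mem_range.mp hk)]
      congr 1
      refine Finset.prod_congr rfl fun i hi => ?_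
      rw [Nat.testBit_two_pow_add_gt (Finset.mem_range.mp hi)]

theorem abs_rademacher (k : ℕ) (x : ℝ) : |rademacher k x| = 1 := by
  simp [rademacher]

theorem measurable_rademacher (k : ℕ) : Measurable (rademacher k) := by
  have h : Measurable fun x : ℝ => ⌊x * 2 ^ (k + 1)⌋ :=
    Int.measurable_floor.comp (measurable_id.mul_const _)
  exact (measurable_from_top (f := fun z : ℤ => (-1 : ℝ) ^ (z.toNat % 2))).comp h

theorem measurable_walsh (n : ℕ) : Measurable (walsh n) := by
  unfold walsh
  refine Finset.measurable_fun_prod _ fun k _ => ?_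
  split_ifs
  · exact measurable_rademacher k
  · exact measurable_const

theorem abs_walsh (n : ℕ) (x : ℝ) : |walsh n x| = 1 := by
  rw [walsh, Finset.abs_prod]
  refine Finset.prod_eq_one fun k _ => ?_
  split_ifs
  · exact abs_rademacher k x
  · exact abs_one

theorem walsh_eq_prod_range {n k : ℕ} (hk : k < 2 ^ n) (x : ℝ) :
    walsh k x = ∏ i ∈ Finset.range n, if k.testBit i then rademacher i x else 1 := by
  have key : ∀ m N, k < 2 ^ m → m ≤ N →
      (∏ i ∈ Finset.range m, if k.testBit i then rademacher i x else 1) =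
        ∏ i ∈ Finset.range N, if k.testBit i then rademacher i x else 1 := by
    intro m N hm hmN
    refine Finset.prod_subset (Finset.range_mono hmN) fun i _ hi => ?_
    rw [Finset.mem_range, not_lt] at hi
    simp [Nat.testBit_lt_two_pow (hm.trans_le (Nat.pow_le_pow_right two_pos hi))]
  rw [walsh, key k _ Nat.lt_two_pow_self (le_max_left k n), key n _ hk (le_max_right k n)]

/-- The Walsh–Dirichlet kernel of order `2 ^ n`. -/
noncomputable def dirichletKernel (n : ℕ) (x y : ℝ) : ℝ :=
  ∑ k ∈ Finset.range (2 ^ n), walsh k x * walsh k y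

theorem dirichletKernel_eq_prod (n : ℕ) (x y : ℝ) :
    dirichletKernel n x y = ∏ i ∈ Finset.range n, (1 + rademacher i x * rademacher i y) := by
  have h := sum_range_two_pow_prod_testBit n
    fun i b => if b then rademacher i x * rademacher i y else 1
  simp only [Bool.false_eq_true, if_false, if_true] at h
  rw [← h, dirichletKernel]
  refine Finset.sum_congr rfl fun k hk => ?_
  rw [walsh_eq_prod_range (Finset.mem_range.mp hk), walsh_eq_prod_range (Finset.mem_range.mp hk),
    ← Finset.prod_mul_distrib]
  refine Finset.prod_congr rfl fun i _ => ?_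
  split_ifs <;> simp

theorem dirichletKernel_nonneg (n : ℕ) (x y : ℝ) : 0 ≤ dirichletKernel n x y := by
  rw [dirichletKernel_eq_prod]
  refine Finset.prod_nonneg fun i _ => ?_
  have h : |rademacher i x * rademacher i y| = 1 := by
    rw [abs_mul, abs_rademacher, abs_rademacher, one_mul]
  linarith [neg_abs_le (rademacher i x * rademacher i y)]

theorem rademacher_natCast_div_two_pow {n i : ℕ} (hi : i < n) (j : ℕ) :
    rademacher i ((j : ℝ) / 2 ^ n) = if j.testBit (n - 1 - i) then -1 else 1 := by
  have h : (j : ℝ) / 2 ^ n * 2 ^ (i + 1) = (j : ℝ) / ((2 ^ (n - 1 - i) : ℕ) : ℝ) := by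
    have e : n = (n - 1 - i) + (i + 1) := by omega
    push_cast
    nth_rw 1 [e]
    rw [pow_add]
    field_simp
  rw [rademacher, binDigit, h, Int.floor_toNat, Nat.floor_div_eq_div,
    Nat.testBit_eq_decide_div_mod_eq]
  rcases Nat.mod_two_eq_zero_or_one (j / 2 ^ (n - 1 - i)) with h | h <;> simp [h]

theorem sum_dirichletKernel (n : ℕ) (x : ℝ) :
    ∑ j ∈ Finset.range (2 ^ n), dirichletKernel n x ((j : ℝ) / 2 ^ n) = 2 ^ n := by
  have h := sum_range_two_pow_prod_testBit n
    fun i b => 1 + rademacher (n - 1 - i) x * if b then -1 else 1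
  have h2 : ∀ i, (1 + rademacher i x * 1) + (1 + rademacher i x * -1) = 2 := fun i => by ring
  simp only [Bool.false_eq_true, if_false, if_true, h2, Finset.prod_const,
    Finset.card_range] at h
  refine Eq.trans (Finset.sum_congr rfl fun j _ => ?_) h
  rw [dirichletKernel_eq_prod, ← Finset.prod_range_reflect]
  refine Finset.prod_congr rfl fun i hi => ?_
  have hi := Finset.mem_range.mp hi
  rw [rademacher_natCast_div_two_pow (by omega), show n - 1 - (n - 1 - i) = i by omega]

theorem intervalIntegrable_mul_walsh {p : ℝ → ℝ} (hp : IntervalIntegrable p volume 0 1) (k : ℕ) :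
    IntervalIntegrable (fun x => p x * walsh k x) volume 0 1 := by
  rw [intervalIntegrable_iff] at hp ⊢
  exact hp.mul_bdd (c := 1) (measurable_walsh k).aestronglyMeasurable
    (Filter.Eventually.of_forall fun x => (abs_walsh k x).le)

theorem intervalIntegrable_mul_dirichletKernel {p : ℝ → ℝ}
    (hp : IntervalIntegrable p volume 0 1) (n : ℕ) (y : ℝ) :
    IntervalIntegrable (fun x => p x * dirichletKernel n x y) volume 0 1 := by
  have h := IntervalIntegrable.sum (Finset.range (2 ^ n))
    fun k _ => (intervalIntegrable_mul_walsh hp k).mul_const (walsh k y)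
  refine h.congr fun x _ => ?_
  simp [dirichletKernel, Finset.mul_sum, mul_assoc]

theorem S2_eq_integral {p : ℝ → ℝ} (hp : IntervalIntegrable p volume 0 1) (n : ℕ) (y : ℝ) :
    S2 n p y = ∫ x in (0:ℝ)..1, p x * dirichletKernel n x y := by
  simp only [dirichletKernel, Finset.mul_sum, ← mul_assoc]
  rw [intervalIntegral.integral_finsetSum
    fun k _ => (intervalIntegrable_mul_walsh hp k).mul_const (walsh k y)]
  simp only [intervalIntegral.integral_mul_const, S2, fcoef]

theorem sum_abs_S2_le {p : ℝ → ℝ} (hp : IntervalIntegrable p volume 0 1) (n : ℕ) :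
    ∑ j ∈ Finset.range (2 ^ n), |S2 n p ((j : ℝ) / 2 ^ n)| ≤
      2 ^ n * ∫ x in (0:ℝ)..1, |p x| := by
  calc
    _ ≤ ∑ j ∈ Finset.range (2 ^ n),
        ∫ x in (0:ℝ)..1, |p x| * dirichletKernel n x ((j : ℝ) / 2 ^ n) := by
      refine Finset.sum_le_sum fun j _ => ?_
      rw [S2_eq_integral hp]
      refine (intervalIntegral.abs_integral_le_integral_abs zero_le_one).trans_eq ?_
      simp only [abs_mul, abs_of_nonneg (dirichletKernel_nonneg _ _ _)]
    _ = 2 ^ n * ∫ x in (0:ℝ)..1, |p x| := by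
      rw [← intervalIntegral.integral_finsetSum
        fun j _ => intervalIntegrable_mul_dirichletKernel hp.abs n _]
      simp only [← Finset.mul_sum, sum_dirichletKernel, intervalIntegral.integral_mul_const]
      ring

theorem one_add_abs_div_le_exp {s : ℝ} (hs : |s| < 1 / 2) :
    1 + |s / (1 - s / 2)| ≤ Real.exp (2 * |s|) := by
  have h1 : 1 / 2 ≤ 1 - s / 2 := by linarith [le_abs_self s]
  have h2 : |s / (1 - s / 2)| ≤ 2 * |s| := by
    rw [abs_div, abs_of_pos (by linarith : 0 < 1 - s / 2), div_le_iff₀ (by linarith)]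
    nlinarith [abs_nonneg s]
  linarith [Real.add_one_le_exp (2 * |s|)]

/-- Product bound: `∏_{j=a}^{b-1} (1 + |ρ^{(n)}_j|) ≤ e^{2∫₀¹|p|}`, where
`ρ^{(n)}_j = (2^{-n} S_{2^n}p(j/2^n)) / (1 − 2^{-(n+1)} S_{2^n}p(j/2^n))`. -/
theorem product_rho_bound (p : ℝ → ℝ) (hpi : IntegrableOn p (Set.Ico (0:ℝ) 1))
    (n : ℕ) (hn : 1 ≤ n)
    (hmax : ∀ k < 2 ^ n, |S2 n p ((k : ℝ) / 2 ^ n)| / 2 ^ n < 1 / 2) :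
    ∀ a b : ℕ, a ≤ b → b ≤ 2 ^ n →
      (∏ j ∈ Finset.Ico a b,
          (1 + |S2 n p ((j : ℝ) / 2 ^ n) / 2 ^ n /
            (1 - S2 n p ((j : ℝ) / 2 ^ n) / 2 ^ (n + 1))|)) ≤
        Real.exp (2 * ∫ x in (0:ℝ)..1, |p x|) := by
  intro a b _ hb
  have hp : IntervalIntegrable p volume 0 1 := by
    rwa [intervalIntegrable_iff_integrableOn_Ico_of_le zero_le_one]
  have hsub : Finset.Ico a b ⊆ Finset.range (2 ^ n) := fun j hj =>
    Finset.mem_range.mpr ((Finset.mem_Ico.mp hj).2.trans_le hb)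
  have hpow : (0 : ℝ) < 2 ^ n := by positivity
  calc
    _ ≤ ∏ j ∈ Finset.Ico a b, Real.exp (2 * (|S2 n p ((j : ℝ) / 2 ^ n)| / 2 ^ n)) := by
      refine Finset.prod_le_prod (fun _ _ => by positivity) fun j hj => ?_
      have habs : |S2 n p ((j : ℝ) / 2 ^ n) / 2 ^ n| = |S2 n p ((j : ℝ) / 2 ^ n)| / 2 ^ n := by
        rw [abs_div, abs_of_pos hpow]
      have h := one_add_abs_div_le_exp
        (habs.trans_lt (hmax j (by exact_mod_cast Finset.mem_range.mp (hsub hj))))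
      rwa [habs, div_div _ _ (2 : ℝ), ← pow_succ] at h
    _ = Real.exp (2 * ((∑ j ∈ Finset.Ico a b, |S2 n p ((j : ℝ) / 2 ^ n)|) / 2 ^ n)) := by
      rw [← Real.exp_sum, ← Finset.mul_sum, ← Finset.sum_div]
    _ ≤ _ := by
      gcongr
      rw [div_le_iff₀' hpow]
      exact (Finset.sum_le_sum_of_subset_of_nonneg hsub fun _ _ _ => abs_nonneg _).trans
        (sum_abs_S2_le hp n)
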